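/- arXiv:2401.10183 — 3 statements merged into one kernel-verified Lean document; each statement's English description precedes it below -/
import Mathlib

section
/- Let v ∈ V be a nonzero vector and let Λ be an invariant lattice normalized at v. Then Λ is maximal with respect to v if and only if the socle of Λ/πΛ is a simple F[G]-module and equals the F[G]-submodule of Λ/πΛ generated by the image of v. -/
noncomputable section

attribute [local instance] Classical.propDecidable

open Pointwise

/-! ### Generic machinery: modules equipped with a family of endomorphisms
indexed by a group `G` (i.e. "`R[G]`-modules"). -/

section Generic

variable {R : Type*} [CommRing R] {M : Type*} [AddCommGroup M] [Module R M]
variable {G : Type*}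

/-- A submodule stable under all the endomorphisms `σ g`. -/
def ActStable (σ : G → M →ₗ[R] M) (W : Submodule R M) : Prop :=
  ∀ g : G, ∀ x ∈ W, σ g x ∈ W

/-- The subquotient `W₂ / W₁`. -/
abbrev SubQuot (W₁ W₂ : Submodule R M) : Type _ :=
  W₂ ⧸ (W₁.comap W₂.subtype)

/-- The endomorphism of `W₂/W₁` induced by `σ g` (junk value `0` if `σ g` does not
preserve `W₁` and `W₂`). -/
noncomputable def subQuotMap (σ : G → M →ₗ[R] M) (W₁ W₂ : Submodule R M) (g : G) :
    SubQuot W₁ W₂ →ₗ[R] SubQuot W₁ W₂ :=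
  if h : (∀ x ∈ W₂, σ g x ∈ W₂) ∧ ∀ x ∈ W₂, x ∈ W₁ → σ g x ∈ W₁ then
    Submodule.mapQ _ _ ((σ g).restrict (p := W₂) (q := W₂) h.1)
      (by intro x hx; exact h.2 x x.2 hx)
  else 0

/-- The endomorphism of a stable submodule `W` induced by `σ g`. -/
noncomputable def subAct (σ : G → M →ₗ[R] M) (W : Submodule R M) (g : G) : W →ₗ[R] W :=
  if h : ∀ x ∈ W, σ g x ∈ W then (σ g).restrict h else 0

/-- The endomorphism of `M ⧸ W` induced by `σ g`. -/
noncomputable def quotMap (σ : G → M →ₗ[R] M) (W : Submodule R M) (g : G) :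
    (M ⧸ W) →ₗ[R] (M ⧸ W) :=
  if h : W ≤ W.comap (σ g) then Submodule.mapQ W W (σ g) h else 0

/-- Two modules-with-`G`-action are isomorphic: there is a linear equivalence
commuting with the two actions. -/
def IsRepIso {N : Type*} [AddCommGroup N] [Module R N]
    (σ : G → M →ₗ[R] M) (τ : G → N →ₗ[R] N) : Prop :=
  ∃ e : M ≃ₗ[R] N, ∀ (g : G) (x : M), e (σ g x) = τ g (e x)

/-- `M` with the action `σ` is a simple module-with-action. -/
def IsSimpleAct (σ : G → M →ₗ[R] M) : Prop :=
  Nontrivial M ∧ ∀ W : Submodule R M, ActStable σ W → W = ⊥ ∨ W = ⊤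

/-- `W` is a simple stable submodule of `M`. -/
def IsSimpleSubmodule (σ : G → M →ₗ[R] M) (W : Submodule R M) : Prop :=
  ActStable σ W ∧ W ≠ ⊥ ∧ ∀ U : Submodule R M, ActStable σ U → U ≤ W → U = ⊥ ∨ U = W

/-- The socle: the sum of all simple stable submodules. -/
def actSocle (σ : G → M →ₗ[R] M) : Submodule R M :=
  sSup {W | IsSimpleSubmodule σ W}

/-- The socle filtration: `socFilt σ 0 = ⊥` and `socFilt σ (k+1)` is the preimage in `M`
of the socle of `M / socFilt σ k`. -/
noncomputable def socFilt (σ : G → M →ₗ[R] M) : ℕ → Submodule R M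
  | 0 => ⊥
  | k + 1 => (actSocle (quotMap σ (socFilt σ k))).comap (socFilt σ k).mkQ

/-- `(A₁, A₂)` is a sharp subquotient: every stable submodule strictly containing `A₁`
contains `A₂`. -/
def IsSharp (σ : G → M →ₗ[R] M) (A₁ A₂ : Submodule R M) : Prop :=
  ActStable σ A₁ ∧ ActStable σ A₂ ∧ A₁ < A₂ ∧
    ∀ W : Submodule R M, ActStable σ W → A₁ < W → A₂ ≤ W

/-- `(A₁, A₂)` is an irreducible subquotient: `A₂/A₁` is simple, i.e. there is no stable
submodule strictly between `A₁` and `A₂`. -/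
def IsIrredSubquot (σ : G → M →ₗ[R] M) (A₁ A₂ : Submodule R M) : Prop :=
  ActStable σ A₁ ∧ ActStable σ A₂ ∧ A₁ < A₂ ∧
    ∀ W : Submodule R M, ActStable σ W → A₁ ≤ W → W ≤ A₂ → W = A₁ ∨ W = A₂

end Generic

/-! ### Lattices in representations over a discretely valued field -/

section LatticeDefs

variable {O : Type*} [CommRing O]
variable {V : Type*} [AddCommGroup V] [Module O V]

/-- A lattice: a finitely generated `O`-submodule of `V` spanning `V` over `K`. -/
def IsLattice (K : Type*) [Field K] [Module K V] (Λ : Submodule O V) : Prop :=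
  Λ.FG ∧ Submodule.span K (Λ : Set V) = ⊤

/-- Two lattices are homothetic: `Λ' = λ • Λ` for some nonzero `λ ∈ K`. -/
def Homothetic (K : Type*) [Field K] [SMul K V] (Λ Λ' : Submodule O V) : Prop :=
  ∃ lam : K, lam ≠ 0 ∧ (Λ' : Set V) = lam • (Λ : Set V)

end LatticeDefs

section Lattices

variable {O : Type*} [CommRing O] [IsDomain O] [IsDiscreteValuationRing O]
variable {K : Type*} [Field K] [Algebra O K] [IsFractionRing O K]
variable {G : Type*} [Group G]
variable {V : Type*} [AddCommGroup V] [Module K V] [Module O V] [IsScalarTower O K V]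

/-- The submodule `πΛ`. -/
def piSmul (π : O) (Λ : Submodule O V) : Submodule O V :=
  Λ.map (LinearMap.lsmul O V π)

/-- The `O`-linear `G`-action on `V`. -/
def resAct (ρ : Representation K G V) : G → V →ₗ[O] V :=
  fun g => (ρ g).restrictScalars O

/-- `Λ` is invariant: `gΛ = Λ` for all `g ∈ G`. -/
def IsInvariantSub (ρ : Representation K G V) (Λ : Submodule O V) : Prop :=
  ∀ g : G, Λ.map (resAct ρ g) = Λ

/-- `Λ` is normalised at `v`: `v ∈ Λ` and `v ∉ πΛ`. -/
def IsNormalizedAt (π : O) (Λ : Submodule O V) (v : V) : Prop :=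
  v ∈ Λ ∧ v ∉ piSmul π Λ

/-- `Λ` is an invariant lattice, normalised at `v`, maximal under inclusion among
invariant lattices normalised at `v`. -/
def IsMaximalAt (ρ : Representation K G V) (π : O) (Λ : Submodule O V) (v : V) : Prop :=
  IsLattice K Λ ∧ IsInvariantSub ρ Λ ∧ IsNormalizedAt π Λ v ∧
    ∀ Λ' : Submodule O V, IsLattice K Λ' → IsInvariantSub ρ Λ' → IsNormalizedAt π Λ' v →
      Λ ≤ Λ' → Λ' = Λ

/-- `Λ` is a maximal invariant lattice: maximal with respect to some nonzero `v`. -/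
def IsMaximalLattice (ρ : Representation K G V) (π : O) (Λ : Submodule O V) : Prop :=
  ∃ v : V, v ≠ 0 ∧ IsMaximalAt ρ π Λ v

/-- `V` is simple as a `K[G]`-module. -/
def IsIrreducibleRep (ρ : Representation K G V) : Prop :=
  Nontrivial V ∧ ∀ W : Submodule K V, (∀ g : G, ∀ x ∈ W, ρ g x ∈ W) → W = ⊥ ∨ W = ⊤

/-- The induced `G`-action on the reduction `Λ/πΛ`. -/
noncomputable def redAct (ρ : Representation K G V) (π : O) (Λ : Submodule O V) :
    G → SubQuot (piSmul π Λ) Λ →ₗ[O] SubQuot (piSmul π Λ) Λ :=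
  subQuotMap (resAct ρ) (piSmul π Λ) Λ

/-- The map `Λ/πΛ → Λ'/πΛ'` induced by an inclusion `Λ ≤ Λ'` (junk value `0` if
`Λ ≰ Λ'`). -/
noncomputable def redMap (π : O) (Λ Λ' : Submodule O V) :
    SubQuot (piSmul π Λ) Λ →ₗ[O] SubQuot (piSmul π Λ') Λ' :=
  if h : Λ ≤ Λ' then
    Submodule.mapQ _ _ (Submodule.inclusion h)
      (by
        intro x hx
        have hx' : (x : V) ∈ piSmul π Λ := hx
        have : (x : V) ∈ piSmul π Λ' := Submodule.map_mono h hx'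
        simpa [Submodule.mem_comap] using this)
  else 0

/-- `ρ` realises a non-split extension of `A` (a module with action `τA`) by `B`
(a module with action `τB`): there are an invariant lattice `L` and submodules
`U₀ ⊆ T ⊆ U₁` of `L/πL` with `T/U₀ ≅ B`, `U₁/T ≅ A`, and `T/U₀` has no stable
complement in `U₁/U₀` (i.e. the extension `0 → B → U₁/U₀ → A → 0` does not split). -/
def RealizesExt (ρ : Representation K G V) (π : O)
    {NA : Type*} [AddCommGroup NA] [Module O NA] {NB : Type*} [AddCommGroup NB] [Module O NB]
    (τA : G → NA →ₗ[O] NA) (τB : G → NB →ₗ[O] NB) : Prop :=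
  ∃ L : Submodule O V, IsLattice K L ∧ IsInvariantSub ρ L ∧
    ∃ U₀ U₁ T : Submodule O (SubQuot (piSmul π L) L),
      ActStable (redAct ρ π L) U₀ ∧ ActStable (redAct ρ π L) U₁ ∧
      ActStable (redAct ρ π L) T ∧ U₀ ≤ T ∧ T ≤ U₁ ∧
      IsRepIso (subQuotMap (redAct ρ π L) U₀ T) τB ∧
      IsRepIso (subQuotMap (redAct ρ π L) T U₁) τA ∧
      ¬ ∃ C : Submodule O (SubQuot (piSmul π L) L), ActStable (redAct ρ π L) C ∧
          U₀ ≤ C ∧ C ≤ U₁ ∧ C ⊓ T = U₀ ∧ C ⊔ T = U₁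

end Lattices

/-- The underlying family of linear endomorphisms of a representation. -/
def ofRep {R : Type*} [CommSemiring R] {G : Type*} [Monoid G] {M : Type*} [AddCommMonoid M]
    [Module R M] (σ : Representation R G M) : G → M →ₗ[R] M := fun g => σ g

section Helpers

section Generic

variable {R : Type*} [CommRing R] {M : Type*} [AddCommGroup M] [Module R M]
variable {G : Type*}

/-- In an Artinian module, every nonzero stable submodule contains a simple one. -/
theorem ActStable.exists_isSimpleSubmodule_le [IsArtinian R M] {σ : G → M →ₗ[R] M}
    {W : Submodule R M} (hW : ActStable σ W) (hne : W ≠ ⊥) :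
    ∃ U ≤ W, IsSimpleSubmodule σ U := by
  obtain ⟨U, ⟨hUs, hU0, hUW⟩, hmin⟩ := IsArtinian.set_has_minimal
    {U : Submodule R M | ActStable σ U ∧ U ≠ ⊥ ∧ U ≤ W} ⟨W, hW, hne, le_rfl⟩
  refine ⟨U, hUW, hUs, hU0, fun U' hU's hle => ?_⟩
  by_contra! h
  exact hmin U' ⟨hU's, h.1, hle.trans hUW⟩ (lt_of_le_of_ne hle h.2)

/-- The span of an orbit is stable. -/
theorem actStable_span_orbit [Group G] {σ : G → M →ₗ[R] M}
    (hmul : ∀ g h x, σ (g * h) x = σ g (σ h x)) (m : M) :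
    ActStable σ (Submodule.span R (Set.range fun g => σ g m)) := by
  intro g
  suffices h : Submodule.span R (Set.range fun g => σ g m) ≤
      (Submodule.span R (Set.range fun g => σ g m)).comap (σ g) from fun x hx => h hx
  rw [Submodule.span_le]
  rintro _ ⟨h, rfl⟩
  exact Submodule.subset_span ⟨g * h, hmul g h m⟩

/-- A nonzero vector lies in every nonzero stable submodule if and only if the socle is
simple and generated by that vector. -/
theorem forall_mem_iff_actSocle_simple [Group G] [IsArtinian R M] {σ : G → M →ₗ[R] M}
    (hone : ∀ x, σ 1 x = x) (hmul : ∀ g h x, σ (g * h) x = σ g (σ h x))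
    {m : M} (hm : m ≠ 0) :
    (∀ W : Submodule R M, ActStable σ W → W ≠ ⊥ → m ∈ W) ↔
      IsSimpleSubmodule σ (actSocle σ) ∧
        actSocle σ = Submodule.span R (Set.range fun g => σ g m) := by
  set S := Submodule.span R (Set.range fun g => σ g m) with hS
  have hmS : m ∈ S := Submodule.subset_span ⟨1, hone m⟩
  constructor
  · intro h
    have hle : ∀ W : Submodule R M, ActStable σ W → W ≠ ⊥ → S ≤ W := by
      intro W hW hne
      rw [hS, Submodule.span_le]
      rintro _ ⟨g, rfl⟩
      exact hW g _ (h W hW hne)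
    have hsimple : IsSimpleSubmodule σ S := by
      refine ⟨actStable_span_orbit hmul m, fun h0 => hm ?_, fun U hU hUS => ?_⟩
      · simpa [h0] using hmS
      · by_cases hU0 : U = ⊥
        · exact Or.inl hU0
        · exact Or.inr (le_antisymm hUS (hle U hU hU0))
    have hsoc : actSocle σ = S := by
      refine le_antisymm (sSup_le fun W hW => ?_) (le_sSup hsimple)
      rcases hW.2.2 S hsimple.1 (hle W hW.1 hW.2.1) with h0 | h0
      · exact absurd h0 hsimple.2.1
      · exact h0.ge
    exact ⟨hsoc ▸ hsimple, hsoc⟩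
  · rintro ⟨hsimple, hsoc⟩ W hW hne
    obtain ⟨U, hUW, hU⟩ := hW.exists_isSimpleSubmodule_le hne
    rcases hsimple.2.2 U hU.1 (le_sSup hU) with h0 | h0
    · exact absurd h0 hU.2.1
    · exact hUW (h0 ▸ hsoc ▸ hmS)

/-- A finitely generated module killed by a maximal ideal is Artinian. -/
theorem isArtinian_of_isTorsionBySet [Module.Finite R M] (I : Ideal R) [I.IsMaximal]
    (h : Module.IsTorsionBySet R M I) : IsArtinian R M := by
  let _ := Ideal.Quotient.field I
  let _ := h.module
  have : IsScalarTower R (R ⧸ I) M := h.isScalarTower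
  have : Module.Finite (R ⧸ I) M := Module.Finite.of_restrictScalars_finite R (R ⧸ I) M
  exact isArtinian_of_surjective_algebraMap (R := R ⧸ I) Ideal.Quotient.mk_surjective

end Generic

section Lattices

variable {O : Type*} [CommRing O]
variable {K : Type*} [Field K]
variable {G : Type*} [Group G]
variable {V : Type*} [AddCommGroup V] [Module K V] [Module O V]

theorem mem_piSmul {π : O} {Λ : Submodule O V} {x : V} :
    x ∈ piSmul π Λ ↔ ∃ y ∈ Λ, π • y = x := Iff.rfl

theorem piSmul_le (π : O) (Λ : Submodule O V) : piSmul π Λ ≤ Λ := by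
  rintro _ ⟨y, hy, rfl⟩
  exact Λ.smul_mem π hy

theorem IsLattice.mono {N L : Submodule O V} (hN : IsLattice K N) (hL : L.FG) (h : N ≤ L) :
    IsLattice K L :=
  ⟨hL, top_le_iff.1 (hN.2 ▸ Submodule.span_mono h)⟩

theorem mk_mem_iff_exists {π : O} {Λ : Submodule O V}
    {W : Submodule O (SubQuot (piSmul π Λ) Λ)} {x : V} :
    x ∈ (W.comap (Submodule.mkQ _)).map Λ.subtype ↔
      ∃ h : x ∈ Λ, (Submodule.Quotient.mk ⟨x, h⟩ : SubQuot (piSmul π Λ) Λ) ∈ W := by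
  constructor
  · rintro ⟨y, hy, rfl⟩
    exact ⟨y.2, hy⟩
  · rintro ⟨h, hx⟩
    exact ⟨⟨x, h⟩, hx, rfl⟩

theorem mk_eq_zero_iff {π : O} {Λ : Submodule O V} {x : Λ} :
    (Submodule.Quotient.mk x : SubQuot (piSmul π Λ) Λ) = 0 ↔ (x : V) ∈ piSmul π Λ :=
  Submodule.Quotient.mk_eq_zero _

theorem IsLattice.isArtinian_reduction [IsDomain O] [IsDiscreteValuationRing O]
    {Λ : Submodule O V} (h : IsLattice K Λ)
    {π : O} (hπ : Irreducible π) : IsArtinian O (SubQuot (piSmul π Λ) Λ) := by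
  have : Module.Finite O Λ := Module.Finite.iff_fg.2 h.1
  have : (Ideal.span {π}).IsMaximal :=
    PrincipalIdealRing.isMaximal_of_irreducible hπ
  refine isArtinian_of_isTorsionBySet (Ideal.span {π}) ?_
  rintro x ⟨a, ha⟩
  obtain ⟨c, rfl⟩ := Ideal.mem_span_singleton'.1 ha
  obtain ⟨x, rfl⟩ := Submodule.Quotient.mk_surjective _ x
  change (c * π) • Submodule.Quotient.mk x = 0
  rw [← Submodule.Quotient.mk_smul, mk_eq_zero_iff]
  exact ⟨c • x, Λ.smul_mem _ x.2, by simp [mul_smul, smul_comm c π]⟩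

variable [Algebra O K] [IsScalarTower O K V]

theorem isInvariantSub_iff {ρ : Representation K G V} {Λ : Submodule O V} :
    IsInvariantSub ρ Λ ↔ ∀ g, ∀ x ∈ Λ, ρ g x ∈ Λ := by
  constructor
  · intro h g x hx
    rw [← h g]
    exact ⟨x, hx, rfl⟩
  · refine fun h g => le_antisymm ?_ fun x hx => ⟨ρ g⁻¹ x, h _ _ hx, ?_⟩
    · rintro _ ⟨x, hx, rfl⟩
      exact h g x hx
    · exact ρ.self_inv_apply g x

theorem rep_smul (ρ : Representation K G V) (g : G) (a : O) (x : V) :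
    ρ g (a • x) = a • ρ g x :=
  ((ρ g).restrictScalars O).map_smul a x

theorem redAct_mk {ρ : Representation K G V} {Λ : Submodule O V}
    (hinv : IsInvariantSub ρ Λ) (π : O) (g : G) (x : Λ) :
    redAct ρ π Λ g (Submodule.Quotient.mk x) =
      Submodule.Quotient.mk ⟨ρ g x, isInvariantSub_iff.1 hinv g x x.2⟩ := by
  have h : (∀ x ∈ Λ, resAct (O := O) ρ g x ∈ Λ) ∧
      ∀ x ∈ Λ, x ∈ piSmul π Λ → resAct (O := O) ρ g x ∈ piSmul π Λ := by
    refine ⟨isInvariantSub_iff.1 hinv g, ?_⟩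
    rintro _ - ⟨y, hy, rfl⟩
    exact ⟨ρ g y, isInvariantSub_iff.1 hinv g y hy, (rep_smul ρ g π y).symm⟩
  unfold redAct subQuotMap
  rw [dif_pos h]
  rfl

variable [IsDomain O] [IsFractionRing O K]

theorem IsLattice.exists_smul_mem {Λ : Submodule O V} (h : IsLattice K Λ) (x : V) :
    ∃ b : O, b ≠ 0 ∧ b • x ∈ Λ := by
  have hx : x ∈ Submodule.span K (Λ : Set V) := h.2 ▸ Submodule.mem_top
  induction hx using Submodule.span_induction with
  | mem x hx => exact ⟨1, one_ne_zero, by simpa using hx⟩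
  | zero => exact ⟨1, one_ne_zero, by simp⟩
  | add x y _ _ hx hy =>
    obtain ⟨a, ha, hax⟩ := hx
    obtain ⟨b, hb, hby⟩ := hy
    refine ⟨a * b, mul_ne_zero ha hb, ?_⟩
    rw [smul_add]
    refine Λ.add_mem ?_ ?_
    · rw [mul_comm, mul_smul]; exact Λ.smul_mem _ hax
    · rw [mul_smul]; exact Λ.smul_mem _ hby
  | smul k x _ hx =>
    obtain ⟨a, ha, hax⟩ := hx
    obtain ⟨c, d, hd, rfl⟩ := IsFractionRing.div_surjective (A := O) k
    have hd0 : algebraMap O K d ≠ 0 :=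
      (map_ne_zero_iff _ (IsFractionRing.injective O K)).2 (nonZeroDivisors.ne_zero hd)
    refine ⟨d * a, mul_ne_zero (nonZeroDivisors.ne_zero hd) ha, ?_⟩
    have : (d * a) • (algebraMap O K c / algebraMap O K d) • x = c • a • x := by
      have hcast : ∀ (r : O) (y : V), r • y = algebraMap O K r • y := fun r y =>
        (algebraMap_smul K r y).symm
      simp only [hcast, smul_smul, map_mul]
      congr 1
      field_simp
    rw [this]
    exact Λ.smul_mem _ hax

theorem IsLattice.exists_smul_le {Λ L : Submodule O V} (h : IsLattice K Λ) (hL : L.FG) :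
    ∃ b : O, b ≠ 0 ∧ ∀ x ∈ L, b • x ∈ Λ := by
  induction L, hL using Submodule.fg_induction with
  | singleton x =>
    obtain ⟨b, hb, hbx⟩ := h.exists_smul_mem x
    refine ⟨b, hb, fun y hy => ?_⟩
    obtain ⟨a, rfl⟩ := Submodule.mem_span_singleton.1 hy
    rw [smul_comm]
    exact Λ.smul_mem _ hbx
  | sup L₁ L₂ _ _ h₁ h₂ =>
    obtain ⟨a, ha, ha'⟩ := h₁
    obtain ⟨b, hb, hb'⟩ := h₂
    refine ⟨a * b, mul_ne_zero ha hb, fun x hx => ?_⟩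
    obtain ⟨y, hy, z, hz, rfl⟩ := Submodule.mem_sup.1 hx
    rw [smul_add]
    refine Λ.add_mem ?_ ?_
    · rw [mul_comm, mul_smul]; exact Λ.smul_mem _ (ha' y hy)
    · rw [mul_smul]; exact Λ.smul_mem _ (hb' z hz)

variable [IsDiscreteValuationRing O]

theorem IsLattice.exists_pow_smul_le {Λ L : Submodule O V} (h : IsLattice K Λ) (hL : L.FG)
    {π : O} (hπ : Irreducible π) : ∃ n : ℕ, ∀ x ∈ L, π ^ n • x ∈ Λ := by
  obtain ⟨b, hb, hbL⟩ := h.exists_smul_le hL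
  obtain ⟨n, u, hu⟩ := IsDiscreteValuationRing.associated_pow_irreducible hb hπ
  refine ⟨n, fun x hx => ?_⟩
  rw [← hu, mul_comm, mul_smul]
  exact Λ.smul_mem _ (hbL x hx)

/-- An invariant lattice normalised at `v` is maximal if and only if the image of `v` lies in
every nonzero stable submodule of the reduction. -/
theorem isMaximalAt_iff_forall_mem {π : O} (hπ : Irreducible π) {ρ : Representation K G V}
    {v : V} {Λ : Submodule O V} (hlat : IsLattice K Λ)
    (hinv : IsInvariantSub ρ Λ) (hnorm : IsNormalizedAt π Λ v) :
    IsMaximalAt ρ π Λ v ↔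
      ∀ W, ActStable (redAct ρ π Λ) W → W ≠ ⊥ → Submodule.Quotient.mk ⟨v, hnorm.1⟩ ∈ W := by
  have hπK : algebraMap O K π ≠ 0 := by simpa using hπ.ne_zero
  have hinj : ∀ x y : V, π • x = π • y → x = y := by
    intro x y hxy
    rw [← algebraMap_smul K, ← algebraMap_smul K π y] at hxy
    exact smul_right_injective V hπK hxy
  have hstab := isInvariantSub_iff.1 hinv
  constructor
  · rintro ⟨-, -, -, hmax⟩ W hW hne
    by_contra hv
    let N : Submodule O V := (W.comap (Submodule.mkQ _)).map Λ.subtype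
    have hπN : piSmul π Λ ≤ N := fun x hx =>
      mk_mem_iff_exists.2 ⟨piSmul_le π Λ hx, by rw [mk_eq_zero_iff.2 hx]; exact W.zero_mem⟩
    have hNfg : N.FG := by
      have : Module.Finite O Λ := Module.Finite.iff_fg.2 hlat.1
      exact (IsNoetherian.noetherian _).map _
    let L : Submodule O V := N.comap (LinearMap.lsmul O V π)
    have hL : ∀ x, x ∈ L ↔ π • x ∈ N := fun x => Iff.rfl
    have hΛL : Λ ≤ L := fun x hx => hπN ⟨x, hx, rfl⟩
    have hsurj : ∀ x : V, ∃ y, π • y = x := fun x =>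
      ⟨(algebraMap O K π)⁻¹ • x, by rw [← algebraMap_smul K, smul_inv_smul₀ hπK]⟩
    have hπL : piSmul π L = N := by
      refine le_antisymm ?_ fun x hx => ?_
      · rintro _ ⟨y, hy, rfl⟩
        exact hy
      · obtain ⟨y, rfl⟩ := hsurj x
        exact ⟨y, hx, rfl⟩
    have hLfg : L.FG :=
      Submodule.fg_of_fg_map_injective (LinearMap.lsmul O V π) (fun x y h => hinj x y h)
        (show (piSmul π L).FG from hπL ▸ hNfg)
    have hLinv : IsInvariantSub ρ L := by
      refine isInvariantSub_iff.2 fun g x hx => ?_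
      obtain ⟨h, hxW⟩ := mk_mem_iff_exists.1 ((hL x).1 hx)
      rw [hL, ← rep_smul]
      refine mk_mem_iff_exists.2 ⟨hstab g _ h, ?_⟩
      have := hW g _ hxW
      rwa [redAct_mk hinv] at this
    have hLnorm : IsNormalizedAt π L v := by
      refine ⟨hΛL hnorm.1, ?_⟩
      rw [hπL]
      exact fun h => hv (mk_mem_iff_exists.1 h).2
    have hLΛ := hmax L (hlat.mono hLfg hΛL) hLinv hLnorm hΛL
    refine hne ((Submodule.eq_bot_iff _).2 fun w hw => ?_)
    obtain ⟨x, rfl⟩ := Submodule.Quotient.mk_surjective _ w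
    have hxN : (x : V) ∈ piSmul π L := hπL ▸ mk_mem_iff_exists.2 ⟨x.2, hw⟩
    exact mk_eq_zero_iff.2 (Submodule.map_mono hLΛ.le hxN)
  · refine fun h => ⟨hlat, hinv, hnorm, fun L hL hLinv hLnorm hΛL => ?_⟩
    have hex := hlat.exists_pow_smul_le hL.1 hπ
    obtain hn | ⟨n, hn⟩ : Nat.find hex = 0 ∨ ∃ n, Nat.find hex = n + 1 := by
      cases Nat.find hex <;> simp
    · refine le_antisymm (fun x hx => ?_) hΛL
      have := Nat.find_spec hex x hx
      rwa [hn, pow_zero, one_smul] at this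
    exfalso
    have hspec := Nat.find_spec hex
    have hmin := Nat.find_min hex (m := n) (by omega)
    rw [hn] at hspec
    let W : Submodule O (SubQuot (piSmul π Λ) Λ) :=
      ((L.map (LinearMap.lsmul O V (π ^ (n + 1)))).comap Λ.subtype).map (Submodule.mkQ _)
    have hW : ActStable (redAct ρ π Λ) W := by
      rintro g _ ⟨⟨_, hyΛ⟩, ⟨y, hy, rfl⟩, rfl⟩
      rw [Submodule.mkQ_apply, redAct_mk hinv]
      exact ⟨_, ⟨ρ g y, isInvariantSub_iff.1 hLinv g y hy, (rep_smul ρ g _ y).symm⟩, rfl⟩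
    have hne : W ≠ ⊥ := by
      intro h0
      refine hmin fun x hx => ?_
      have hmem : (Submodule.Quotient.mk ⟨_, hspec x hx⟩ : SubQuot (piSmul π Λ) Λ) ∈ W :=
        ⟨⟨_, hspec x hx⟩, ⟨x, hx, rfl⟩, rfl⟩
      rw [h0, Submodule.mem_bot, mk_eq_zero_iff] at hmem
      obtain ⟨y, hy, hyx⟩ := mem_piSmul.1 hmem
      have : y = π ^ n • x := hinj _ _ (by rw [smul_smul, ← pow_succ']; exact hyx)
      exact this ▸ hy
    obtain ⟨⟨_, hyΛ⟩, ⟨y, hy, rfl⟩, hyv⟩ := h W hW hne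
    have hdiff := (Submodule.Quotient.eq _).1 hyv.symm
    obtain ⟨z, hz, hzv⟩ := mem_piSmul.1 (show v - π ^ (n + 1) • y ∈ piSmul π Λ from hdiff)
    refine hLnorm.2 ⟨z + π ^ n • y, L.add_mem (hΛL hz) (L.smul_mem _ hy), ?_⟩
    change π • (z + π ^ n • y) = v
    rw [smul_add, hzv, smul_smul, ← pow_succ', sub_add_cancel]

end Lattices

end Helpers

section Statement

variable {O : Type*} [CommRing O] [IsDomain O] [IsDiscreteValuationRing O]
variable {K : Type*} [Field K] [Algebra O K] [IsFractionRing O K]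
variable {G : Type*} [Group G]
variable {V : Type*} [AddCommGroup V] [Module K V] [Module O V] [IsScalarTower O K V]
variable [FiniteDimensional K V]

theorem statement_2 (π : O) (hπ : Irreducible π) (ρ : Representation K G V)
    (v : V) (hv : v ≠ 0) (Λ : Submodule O V) (hlat : IsLattice K Λ)
    (hinv : IsInvariantSub ρ Λ) (hnorm : IsNormalizedAt π Λ v) :
    IsMaximalAt ρ π Λ v ↔
      IsSimpleSubmodule (redAct ρ π Λ) (actSocle (redAct ρ π Λ)) ∧
        actSocle (redAct ρ π Λ) =
          Submodule.span O (Set.range fun g : G =>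
            redAct ρ π Λ g (Submodule.Quotient.mk ⟨v, hnorm.1⟩)) := by
  have := hlat.isArtinian_reduction hπ
  rw [isMaximalAt_iff_forall_mem hπ hlat hinv hnorm]
  refine forall_mem_iff_actSocle_simple ?_ ?_ fun h => hnorm.2 (mk_eq_zero_iff.1 h)
  · intro x
    obtain ⟨x, rfl⟩ := Submodule.Quotient.mk_surjective _ x
    simp [redAct_mk hinv]
  · intro g h x
    obtain ⟨x, rfl⟩ := Submodule.Quotient.mk_surjective _ x
    simp [redAct_mk hinv]

end Statement
end
end

section
/- Let M be a finite-dimensional F[G]-module and let (V₁, V₂) be an irreducible subquotient of M. Then there exists a sharp subquotient (V₁', V₂') of M lying above (V₁, V₂), i.e., with V₂ ⊆ V₂' and V₂ ∩ V₁' = V₁. -/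
noncomputable section

attribute [local instance] Classical.propDecidable

open Pointwise

section ActStable

variable {R : Type*} [CommRing R] {M : Type*} [AddCommGroup M] [Module R M] {G : Type*}
  {σ : G → M →ₗ[R] M} {A B : Submodule R M}

theorem ActStable.inf (hA : ActStable σ A) (hB : ActStable σ B) : ActStable σ (A ⊓ B) :=
  fun g x hx => ⟨hA g x hx.1, hB g x hx.2⟩

theorem ActStable.sup (hA : ActStable σ A) (hB : ActStable σ B) : ActStable σ (A ⊔ B) := by
  intro g x hx
  obtain ⟨a, ha, b, hb, rfl⟩ := Submodule.mem_sup.1 hx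
  rw [map_add]
  exact Submodule.add_mem_sup (hA g a ha) (hB g b hb)

end ActStable

section Statement

variable {F : Type*} [Field F] {G : Type*} [Group G]
variable {M : Type*} [AddCommGroup M] [Module F M] [FiniteDimensional F M]

theorem statement_3 (σ : Representation F G M) (V₁ V₂ : Submodule F M)
    (h : IsIrredSubquot (ofRep σ) V₁ V₂) :
    ∃ V₁' V₂' : Submodule F M,
      IsSharp (ofRep σ) V₁' V₂' ∧ V₂ ≤ V₂' ∧ V₂ ⊓ V₁' = V₁ := by
  obtain ⟨h₁, h₂, hlt, hirr⟩ := h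
  obtain ⟨A, ⟨hA, hAV⟩, hmax⟩ := wellFounded_gt.has_min
    {W : Submodule F M | ActStable (ofRep σ) W ∧ V₂ ⊓ W = V₁}
    ⟨V₁, h₁, inf_eq_right.2 hlt.le⟩
  refine ⟨A, V₂ ⊔ A, ⟨hA, h₂.sup hA, ?_, fun W hW hAW => ?_⟩, le_sup_left, hAV⟩
  · refine right_lt_sup.2 fun hle => hlt.ne ?_
    rw [← hAV, inf_eq_left.2 hle]
  · have hV₁ : V₁ ≤ V₂ ⊓ W := hAV ▸ inf_le_inf_left V₂ hAW.le
    rcases hirr (V₂ ⊓ W) (h₂.inf hW) hV₁ inf_le_left with he | he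
    · exact absurd hAW (hmax W ⟨hW, he⟩)
    · exact sup_le (inf_eq_left.1 he) hAW.le

end Statement
end
end

section
/- Let M be a finite-dimensional F[G]-module of length c (as an F[G]-module). Then the set of sharp subquotients of M has cardinality at least c. -/
noncomputable section

attribute [local instance] Classical.propDecidable

open Pointwise

section SharpHelpers

variable {R : Type*} [CommRing R] {M : Type*} [AddCommGroup M] [Module R M]
variable {G : Type*} {σ : G → M →ₗ[R] M}

theorem ActStable.inf_s5 {U W : Submodule R M} (hU : ActStable σ U) (hW : ActStable σ W) :
    ActStable σ (U ⊓ W) :=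
  fun g x hx => ⟨hU g x hx.1, hW g x hx.2⟩

theorem ActStable.sup_s5 {U W : Submodule R M} (hU : ActStable σ U) (hW : ActStable σ W) :
    ActStable σ (U ⊔ W) := by
  intro g x hx
  obtain ⟨u, hu, w, hw, rfl⟩ := Submodule.mem_sup.1 hx
  rw [map_add]
  exact Submodule.add_mem_sup (hU g u hu) (hW g w hw)

/-- Every irreducible subquotient `(U, V)` of a Noetherian module is represented by a sharp
subquotient `(A, A ⊔ V)` with `A ⊓ V = U`. -/
theorem IsIrredSubquot.exists_isSharp [IsNoetherian R M] {U V : Submodule R M}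
    (h : IsIrredSubquot σ U V) : ∃ A : Submodule R M, A ⊓ V = U ∧ IsSharp σ A (A ⊔ V) := by
  obtain ⟨hU, hV, hlt, hirr⟩ := h
  obtain ⟨A, ⟨hA, hAV⟩, hmax⟩ :=
    WellFounded.has_min (wellFounded_gt (α := Submodule R M))
      {A | ActStable σ A ∧ A ⊓ V = U} ⟨U, hU, inf_eq_left.2 hlt.le⟩
  refine ⟨A, hAV, hA, hA.sup_s5 hV, left_lt_sup.2 fun hVA => ?_, fun W hW hAW => ?_⟩
  · exact hlt.ne (hAV.symm.trans (inf_eq_right.2 hVA))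
  · rcases hirr (W ⊓ V) (hW.inf_s5 hV) (hAV.ge.trans (inf_le_inf_right V hAW.le)) inf_le_right
      with hWV | hWV
    · exact absurd hAW (hmax W ⟨hW, hWV⟩)
    · exact sup_le hAW.le (inf_eq_right.1 hWV)

end SharpHelpers

section Statement

variable {F : Type*} [Field F] {G : Type*} [Group G]
variable {M : Type*} [AddCommGroup M] [Module F M] [FiniteDimensional F M]

theorem statement_5 (σ : Representation F G M) (c : ℕ)
    (s : Fin (c + 1) → Submodule F M) (h0 : s 0 = ⊥) (hc : s (Fin.last c) = ⊤)
    (hstep : ∀ k : Fin c, IsIrredSubquot (ofRep σ) (s k.castSucc) (s k.succ)) :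
    ∃ f : Fin c → Submodule F M × Submodule F M,
      Function.Injective f ∧ ∀ k, IsSharp (ofRep σ) (f k).1 (f k).2 := by
  choose A hA hsharp using fun k => (hstep k).exists_isSharp
  have hmono : Monotone s := Fin.monotone_iff_le_succ.2 fun k => (hstep k).2.2.1.le
  have hne : ∀ k l, k < l → A k ≠ A l := by
    intro k l hkl heq
    have hle : s k.succ ≤ A k :=
      (hmono (Fin.succ_le_castSucc_iff.2 hkl)).trans (heq ▸ (hA l).ge.trans inf_le_left)
    exact (hstep k).2.2.1.ne ((hA k).symm.trans (inf_eq_right.2 hle))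
  refine ⟨fun k => (A k, A k ⊔ s k.succ), fun k l hkl => ?_, hsharp⟩
  have heq : A k = A l := congrArg Prod.fst hkl
  rcases lt_trichotomy k l with h | h | h
  · exact absurd heq (hne k l h)
  · exact h
  · exact absurd heq.symm (hne l k h)

end Statement
end
end
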